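/- arXiv:math/0212155 — 2 statements merged into one kernel-verified Lean document; each statement's English description precedes it below -/
import Mathlib

section
/- For any natural numbers m ≥ 1 and n ≥ 1 and complex numbers z, τ, σ with Im τ > 0 and Im σ > 0, Γ(z, τ, σ) = ∏_{a=0}^{m−1} ∏_{b=0}^{n−1} Γ(z + aτ + bσ, mτ, nσ), for all z where both sides are defined (all denominator factors nonzero). -/
open Complex Real Filter

/-- The q-Pochhammer infinite product `(x; q) = ∏_{j=0}^∞ (1 - x q^j)`. -/
noncomputable def qPoch (x q : ℂ) : ℂ := ∏' j : ℕ, (1 - x * q ^ j)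

/-- The Jacobi theta function `θ₀(z,τ) = (x;q)(q/x;q)` with `x = e^{2πiz}`, `q = e^{2πiτ}`. -/
noncomputable def theta₀ (z τ : ℂ) : ℂ :=
  qPoch (Complex.exp (2 * Real.pi * Complex.I * z)) (Complex.exp (2 * Real.pi * Complex.I * τ)) *
  qPoch (Complex.exp (2 * Real.pi * Complex.I * τ) / Complex.exp (2 * Real.pi * Complex.I * z))
    (Complex.exp (2 * Real.pi * Complex.I * τ))

/-- The elliptic gamma function
`Γ(z,τ,σ) = ∏_{j,k≥0} (1 - e^{2πi((j+1)τ+(k+1)σ-z)}) / (1 - e^{2πi(jτ+kσ+z)})`. -/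
noncomputable def ellipticGamma (z τ σ : ℂ) : ℂ :=
  ∏' p : ℕ × ℕ,
    (1 - Complex.exp (2 * Real.pi * Complex.I *
        (((p.1 : ℂ) + 1) * τ + ((p.2 : ℂ) + 1) * σ - z))) /
    (1 - Complex.exp (2 * Real.pi * Complex.I * ((p.1 : ℂ) * τ + (p.2 : ℂ) * σ + z)))

/-- All denominator factors of the product defining `Γ(z,τ,σ)` are nonzero. -/
def EllipticGammaDefined (z τ σ : ℂ) : Prop :=
  ∀ j k : ℕ, Complex.exp (2 * Real.pi * Complex.I * ((j : ℂ) * τ + (k : ℂ) * σ + z)) ≠ 1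

/-- The normalized elliptic gamma function
`Γ̄(z,τ,σ) = ((q;q)/(r;r)) θ₀(τ,σ)^{1-z} Γ(zτ,τ,σ)` with `q = e^{2πiτ}`, `r = e^{2πiσ}`;
the power is the principal-branch complex power. -/
noncomputable def ellipticGammaBar (z τ σ : ℂ) : ℂ :=
  (qPoch (Complex.exp (2 * Real.pi * Complex.I * τ)) (Complex.exp (2 * Real.pi * Complex.I * τ)) /
   qPoch (Complex.exp (2 * Real.pi * Complex.I * σ)) (Complex.exp (2 * Real.pi * Complex.I * σ))) *
  theta₀ τ σ ^ (1 - z) * ellipticGamma (z * τ) τ σ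

/-- Jackson's q-gamma function `Γ_q(z) = (1-q)^{1-z} (q;q)/(q^z;q)`, `q = e^{2πiτ}`,
with principal-branch powers. -/
noncomputable def qGammaTrig (z τ : ℂ) : ℂ :=
  (1 - Complex.exp (2 * Real.pi * Complex.I * τ)) ^ (1 - z) *
    qPoch (Complex.exp (2 * Real.pi * Complex.I * τ)) (Complex.exp (2 * Real.pi * Complex.I * τ)) /
    qPoch (Complex.exp (2 * Real.pi * Complex.I * τ * z)) (Complex.exp (2 * Real.pi * Complex.I * τ))

/-- The summands `e^{2πi(jτ+kσ+w)}` of a double `q`-product. -/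
noncomputable def expTerm (w τ σ : ℂ) (p : ℕ × ℕ) : ℂ :=
  Complex.exp (2 * Real.pi * Complex.I * ((p.1 : ℂ) * τ + (p.2 : ℂ) * σ + w))

/-- The double `q`-product `∏_{j,k≥0} (1 - e^{2πi(jτ+kσ+w)})`. -/
noncomputable def doublePoch (w τ σ : ℂ) : ℂ := ∏' p : ℕ × ℕ, (1 - expTerm w τ σ p)

theorem norm_exp_two_pi_I_mul_lt_one {τ : ℂ} (hτ : 0 < τ.im) :
    ‖Complex.exp (2 * Real.pi * Complex.I * τ)‖ < 1 := by
  rw [Complex.norm_exp, Real.exp_lt_one_iff]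
  have : 0 < 2 * Real.pi * τ.im := by positivity
  simpa using this

theorem expTerm_eq_mul_pow (w τ σ : ℂ) (p : ℕ × ℕ) :
    expTerm w τ σ p = Complex.exp (2 * Real.pi * Complex.I * w) *
      (Complex.exp (2 * Real.pi * Complex.I * τ) ^ p.1 *
        Complex.exp (2 * Real.pi * Complex.I * σ) ^ p.2) := by
  rw [expTerm, ← Complex.exp_nat_mul, ← Complex.exp_nat_mul, ← Complex.exp_add, ← Complex.exp_add]
  congr 1
  ring

theorem summable_norm_expTerm (w : ℂ) {τ σ : ℂ} (hτ : 0 < τ.im) (hσ : 0 < σ.im) :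
    Summable fun p ↦ ‖-expTerm w τ σ p‖ := by
  have h := (summable_geometric_of_lt_one (norm_nonneg _)
    (norm_exp_two_pi_I_mul_lt_one hτ)).mul_of_nonneg
    (summable_geometric_of_lt_one (norm_nonneg _) (norm_exp_two_pi_I_mul_lt_one hσ))
    (fun _ ↦ by positivity) (fun _ ↦ by positivity)
  refine (h.mul_left ‖Complex.exp (2 * Real.pi * Complex.I * w)‖).congr fun p ↦ ?_
  simp only [norm_neg, expTerm_eq_mul_pow, norm_mul, norm_pow]

theorem multipliable_one_sub_expTerm (w : ℂ) {τ σ : ℂ} (hτ : 0 < τ.im) (hσ : 0 < σ.im) :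
    Multipliable fun p ↦ 1 - expTerm w τ σ p := by
  simpa only [sub_eq_add_neg] using
    multipliable_one_add_of_summable (summable_norm_expTerm w hτ hσ)

theorem EllipticGammaDefined.doublePoch_ne_zero {z τ σ : ℂ} (h : EllipticGammaDefined z τ σ)
    (hτ : 0 < τ.im) (hσ : 0 < σ.im) : doublePoch z τ σ ≠ 0 := by
  simpa only [doublePoch, sub_eq_add_neg] using tprod_one_add_ne_zero_of_summable
    (f := fun p ↦ -expTerm z τ σ p)
    (fun p ↦ by rw [← sub_eq_add_neg]; exact sub_ne_zero.2 (h p.1 p.2).symm)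
    (summable_norm_expTerm z hτ hσ)

theorem EllipticGammaDefined.ellipticGamma_eq_div {z τ σ : ℂ} (h : EllipticGammaDefined z τ σ)
    (hτ : 0 < τ.im) (hσ : 0 < σ.im) :
    ellipticGamma z τ σ = doublePoch (τ + σ - z) τ σ / doublePoch z τ σ := by
  rw [doublePoch, doublePoch, ← (multipliable_one_sub_expTerm (τ + σ - z) hτ hσ).tprod_div₀
    (multipliable_one_sub_expTerm z hτ hσ) (h.doublePoch_ne_zero hτ hσ), ellipticGamma]
  refine tprod_congr fun p ↦ ?_
  simp only [expTerm]
  congr 4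
  ring

/-- Division with remainder by `m` and `n` on the two components of `ℕ × ℕ`. -/
def residueProdEquiv (m n : ℕ) [NeZero m] [NeZero n] : (Fin m × Fin n) × (ℕ × ℕ) ≃ ℕ × ℕ :=
  ((Equiv.prodComm _ _).trans (Equiv.prodProdProdComm _ _ _ _)).trans
    ((Nat.divModEquiv m).prodCongr (Nat.divModEquiv n)).symm

theorem residueProdEquiv_apply (m n : ℕ) [NeZero m] [NeZero n] (a : Fin m) (b : Fin n)
    (p : ℕ × ℕ) : residueProdEquiv m n ((a, b), p) = (p.1 * m + a, p.2 * n + b) :=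
  rfl

theorem expTerm_residueProdEquiv (m n : ℕ) [NeZero m] [NeZero n] (w τ σ : ℂ) (a : Fin m)
    (b : Fin n) (p : ℕ × ℕ) : expTerm w τ σ (residueProdEquiv m n ((a, b), p)) =
      expTerm (w + ((a : ℕ) : ℂ) * τ + ((b : ℕ) : ℂ) * σ) ((m : ℂ) * τ) ((n : ℂ) * σ) p := by
  rw [residueProdEquiv_apply, expTerm, expTerm]
  congr 1
  push_cast
  ring

theorem doublePoch_split (m n : ℕ) [NeZero m] [NeZero n] (w : ℂ) {τ σ : ℂ}
    (hτ : 0 < τ.im) (hσ : 0 < σ.im) :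
    doublePoch w τ σ = ∏ a ∈ Finset.range m, ∏ b ∈ Finset.range n,
      doublePoch (w + (a : ℂ) * τ + (b : ℂ) * σ) ((m : ℂ) * τ) ((n : ℂ) * σ) := by
  have hmτ : 0 < ((m : ℂ) * τ).im := by simpa using mul_pos (Nat.cast_pos.2 (NeZero.pos m)) hτ
  have hnσ : 0 < ((n : ℂ) * σ).im := by simpa using mul_pos (Nat.cast_pos.2 (NeZero.pos n)) hσ
  have hmul : Multipliable fun x ↦ 1 - expTerm w τ σ (residueProdEquiv m n x) :=
    ((residueProdEquiv m n).multipliable_iff (f := fun p ↦ 1 - expTerm w τ σ p)).2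
      (multipliable_one_sub_expTerm w hτ hσ)
  have hfib (c : Fin m × Fin n) :
      Multipliable fun p ↦ 1 - expTerm w τ σ (residueProdEquiv m n (c, p)) := by
    obtain ⟨a, b⟩ := c
    simp only [expTerm_residueProdEquiv]
    exact multipliable_one_sub_expTerm _ hmτ hnσ
  rw [doublePoch, ← (residueProdEquiv m n).tprod_eq, hmul.tprod_prod' hfib, tprod_fintype,
    Fintype.prod_prod_type, Finset.prod_range]
  refine Finset.prod_congr rfl fun a _ ↦ ?_
  rw [Finset.prod_range]
  refine Finset.prod_congr rfl fun b _ ↦ ?_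
  simp only [expTerm_residueProdEquiv, doublePoch]

/-- `Γ(z,τ,σ) = ∏_{a=0}^{m-1} ∏_{b=0}^{n-1} Γ(z + aτ + bσ, mτ, nσ)`. -/
theorem ellipticGamma_split (m n : ℕ) (hm : 1 ≤ m) (hn : 1 ≤ n) (z τ σ : ℂ)
    (hτ : 0 < τ.im) (hσ : 0 < σ.im)
    (h0 : EllipticGammaDefined z τ σ)
    (h1 : ∀ a b : ℕ, a < m → b < n →
      EllipticGammaDefined (z + (a : ℂ) * τ + (b : ℂ) * σ) ((m : ℂ) * τ) ((n : ℂ) * σ)) :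
    ellipticGamma z τ σ =
      ∏ a ∈ Finset.range m, ∏ b ∈ Finset.range n,
        ellipticGamma (z + (a : ℂ) * τ + (b : ℂ) * σ) ((m : ℂ) * τ) ((n : ℂ) * σ) := by
  have : NeZero m := ⟨by lia⟩
  have : NeZero n := ⟨by lia⟩
  have hmτ : 0 < ((m : ℂ) * τ).im := by simpa using mul_pos (Nat.cast_pos.2 (NeZero.pos m)) hτ
  have hnσ : 0 < ((n : ℂ) * σ).im := by simpa using mul_pos (Nat.cast_pos.2 (NeZero.pos n)) hσ
  have hsplit : ∏ a ∈ Finset.range m, ∏ b ∈ Finset.range n,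
      ellipticGamma (z + (a : ℂ) * τ + (b : ℂ) * σ) ((m : ℂ) * τ) ((n : ℂ) * σ) =
      ∏ a ∈ Finset.range m, ∏ b ∈ Finset.range n,
        doublePoch (m * τ + n * σ - (z + (a : ℂ) * τ + (b : ℂ) * σ)) (m * τ) (n * σ) /
          doublePoch (z + (a : ℂ) * τ + (b : ℂ) * σ) (m * τ) (n * σ) :=
    Finset.prod_congr rfl fun a ha ↦ Finset.prod_congr rfl fun b hb ↦
      (h1 a b (Finset.mem_range.1 ha) (Finset.mem_range.1 hb)).ellipticGamma_eq_div hmτ hnσ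
  rw [hsplit, h0.ellipticGamma_eq_div hτ hσ, doublePoch_split m n (τ + σ - z) hτ hσ,
    doublePoch_split m n z hτ hσ]
  simp only [Finset.prod_div_distrib]
  congr 1
  rw [← Finset.prod_range_reflect]
  refine Finset.prod_congr rfl fun a ha ↦ ?_
  rw [← Finset.prod_range_reflect]
  refine Finset.prod_congr rfl fun b hb ↦ ?_
  have ha' : ((m - 1 - a : ℕ) : ℂ) = m - 1 - a := by
    have := Finset.mem_range.1 ha
    rw [Nat.cast_sub (by lia), Nat.cast_sub hm, Nat.cast_one]
  have hb' : ((n - 1 - b : ℕ) : ℂ) = n - 1 - b := by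
    have := Finset.mem_range.1 hb
    rw [Nat.cast_sub (by lia), Nat.cast_sub hn, Nat.cast_one]
  rw [ha', hb']
  congr 1
  ring
end

section
/- (Askey's duplication formula.) For complex numbers z and τ with Im τ > 0, Jackson's q-gamma function with q = e^{2πiτ} satisfies Γ_q(2z) · Γ_{q²}(1/2) = [2]_q^{2z−1} · Γ_{q²}(z) · Γ_{q²}(z + 1/2), where [2]_q = (1 − q²)/(1 − q) = 1 + q and the complex power [2]_q^{2z−1} is taken with the principal branch, for all z where all factors are defined and nonzero. -/
open Complex Real Filter

theorem multipliable_one_sub_mul_pow (x : ℂ) {q : ℂ} (hq : ‖q‖ < 1) :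
    Multipliable fun j : ℕ => 1 - x * q ^ j := by
  have h : Summable fun j : ℕ => ‖-(x * q ^ j)‖ := by
    simp only [norm_neg, norm_mul, norm_pow]
    exact (summable_geometric_of_lt_one (norm_nonneg q) hq).mul_left _
  simpa [sub_eq_add_neg] using multipliable_one_add_of_summable h

/-- Splitting `(x; q)` into its even- and odd-indexed factors. -/
theorem qPoch_eq_mul_qPoch_sq (x : ℂ) {q : ℂ} (hq : ‖q‖ < 1) :
    qPoch x q = qPoch x (q ^ 2) * qPoch (x * q) (q ^ 2) := by
  have hq2 : ‖q ^ 2‖ < 1 := by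
    rw [norm_pow]
    exact pow_lt_one₀ (norm_nonneg q) hq two_ne_zero
  have he := multipliable_one_sub_mul_pow x hq2
  have ho := multipliable_one_sub_mul_pow (x * q) hq2
  have e1 (k : ℕ) : 1 - x * (q ^ 2) ^ k = 1 - x * q ^ (2 * k) := by ring
  have e2 (k : ℕ) : 1 - x * q * (q ^ 2) ^ k = 1 - x * q ^ (2 * k + 1) := by
    ring
  simp only [e1] at he
  simp only [e2] at ho
  simp only [qPoch, e1, e2]
  exact (tprod_even_mul_odd (f := fun j => 1 - x * q ^ j) he ho).symm

theorem mul_cpow_of_re_pos {a b : ℂ} (ha : 0 < a.re) (hb : 0 < b.re) (c : ℂ) :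
    (a * b) ^ c = a ^ c * b ^ c := by
  have ha0 : a ≠ 0 := by rintro rfl; simp at ha
  have hb0 : b ≠ 0 := by rintro rfl; simp at hb
  have h1 := abs_lt.1 (Complex.abs_arg_lt_pi_div_two_iff.2 (Or.inl ha))
  have h2 := abs_lt.1 (Complex.abs_arg_lt_pi_div_two_iff.2 (Or.inl hb))
  have hlog : Complex.log (a * b) = Complex.log a + Complex.log b :=
    (Complex.log_mul_eq_add_log_iff ha0 hb0).2 ⟨by linarith [h1.1, h2.1], by linarith [h1.2, h2.2]⟩
  rw [Complex.cpow_def_of_ne_zero (mul_ne_zero ha0 hb0), Complex.cpow_def_of_ne_zero ha0,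
    Complex.cpow_def_of_ne_zero hb0, hlog, add_mul, Complex.exp_add]

/-- Askey's duplication formula
`Γ_q(2z) Γ_{q²}(1/2) = [2]_q^{2z-1} Γ_{q²}(z) Γ_{q²}(z+1/2)`, with `q = e^{2πiτ}`,
`[2]_q = (1-q²)/(1-q)`, principal-branch powers. -/
theorem qGamma_askey_duplication (z τ : ℂ) (hτ : 0 < τ.im)
    (h1 : qGammaTrig (2 * z) τ ≠ 0)
    (h2 : qGammaTrig (1 / 2) (2 * τ) ≠ 0)
    (h3 : qGammaTrig z (2 * τ) ≠ 0)
    (h4 : qGammaTrig (z + 1 / 2) (2 * τ) ≠ 0) :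
    qGammaTrig (2 * z) τ * qGammaTrig (1 / 2) (2 * τ) =
      ((1 - Complex.exp (2 * Real.pi * Complex.I * τ) ^ 2) /
          (1 - Complex.exp (2 * Real.pi * Complex.I * τ))) ^ (2 * z - 1) *
        qGammaTrig z (2 * τ) * qGammaTrig (z + 1 / 2) (2 * τ) := by
  have hq : ‖Complex.exp (2 * Real.pi * Complex.I * τ)‖ < 1 := by
    rw [Complex.norm_exp, Real.exp_lt_one_iff]
    have : (2 * Real.pi * Complex.I * τ).re = -(2 * Real.pi * τ.im) := by simp
    rw [this]
    have := Real.pi_pos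
    simp only [Left.neg_neg_iff]
    positivity
  have eQ : Complex.exp (2 * Real.pi * Complex.I * (2 * τ)) =
      Complex.exp (2 * Real.pi * Complex.I * τ) ^ 2 := by
    rw [← Complex.exp_nat_mul]; congr 1; push_cast; ring
  have ehalf : Complex.exp (2 * Real.pi * Complex.I * (2 * τ) * (1 / 2)) =
      Complex.exp (2 * Real.pi * Complex.I * τ) := by
    congr 1; ring
  have ez : Complex.exp (2 * Real.pi * Complex.I * τ * (2 * z)) =
      Complex.exp (2 * Real.pi * Complex.I * (2 * τ) * z) := by
    congr 1; ring
  have ez' : Complex.exp (2 * Real.pi * Complex.I * (2 * τ) * (z + 1 / 2)) =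
      Complex.exp (2 * Real.pi * Complex.I * (2 * τ) * z) *
        Complex.exp (2 * Real.pi * Complex.I * τ) := by
    rw [← Complex.exp_add]; congr 1; ring
  have hne : qPoch (Complex.exp (2 * Real.pi * Complex.I * τ))
      (Complex.exp (2 * Real.pi * Complex.I * τ) ^ 2) ≠ 0 := by
    intro h
    apply h2
    rw [qGammaTrig, ehalf, eQ, h, div_zero]
  simp only [qGammaTrig, ehalf, ez, ez', eQ]
  rw [qPoch_eq_mul_qPoch_sq _ hq, qPoch_eq_mul_qPoch_sq (Complex.exp (_ * z)) hq, ← pow_two]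
  generalize Complex.exp (2 * Real.pi * Complex.I * τ) = q at *
  generalize Complex.exp (2 * Real.pi * Complex.I * (2 * τ) * z) = x at *
  have hre := abs_lt.1 ((Complex.abs_re_le_norm q).trans_lt hq)
  have hm : 0 < (1 - q).re := by simpa using hre.2
  have hp : 0 < (1 + q).re := by simp only [Complex.add_re, Complex.one_re]; linarith [hre.1]
  have hm0 : 1 - q ≠ 0 := by intro h; simp [h] at hm
  have hp0 : 1 + q ≠ 0 := by intro h; simp [h] at hp
  have hfac : 1 - q ^ 2 = (1 - q) * (1 + q) := by ring
  have hQ0 : 1 - q ^ 2 ≠ 0 := hfac ▸ mul_ne_zero hm0 hp0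
  have hdiv : (1 - q ^ 2) / (1 - q) = 1 + q := by rw [hfac, mul_div_cancel_left₀ _ hm0]
  have hpow : (1 - q) ^ (1 - 2 * z) * (1 - q ^ 2) ^ (1 - 1 / 2 : ℂ) =
      (1 + q) ^ (2 * z - 1) * ((1 - q ^ 2) ^ (1 - z) * (1 - q ^ 2) ^ (1 - (z + 1 / 2))) := by
    rw [← Complex.cpow_add _ _ hQ0,
      show 1 - z + (1 - (z + 1 / 2)) = (1 - 2 * z) + (1 - 1 / 2 : ℂ) by ring,
      Complex.cpow_add _ _ hQ0]
    have h : (1 - q ^ 2) ^ (1 - 2 * z) = (1 - q) ^ (1 - 2 * z) * (1 + q) ^ (1 - 2 * z) := by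
      rw [hfac, mul_cpow_of_re_pos hm hp]
    have h' : (1 + q) ^ (2 * z - 1) * (1 + q) ^ (1 - 2 * z) = 1 := by
      rw [← Complex.cpow_add _ _ hp0]; simp
    rw [h]
    linear_combination (-(1 - q) ^ (1 - 2 * z) * (1 - q ^ 2) ^ (1 - 1 / 2 : ℂ)) * h'
  rw [hdiv]
  generalize qPoch q (q ^ 2) = A at *
  generalize qPoch (q ^ 2) (q ^ 2) = B at *
  calc _ = ((1 - q) ^ (1 - 2 * z) * (1 - q ^ 2) ^ (1 - 1 / 2 : ℂ)) * (A / A) * B ^ 2 /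
        (qPoch x (q ^ 2) * qPoch (x * q) (q ^ 2)) := by ring
    _ = _ := by rw [hpow, div_self hne]; ring
end
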